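/- Let m ≥ 1, let ζ ∈ L' be a primitive p^m-th root of unity, let r ∈ ℝ≥0 and let μ be a continuous linear functional on C^r(ℤ_p, L'); set a_i := μ(z ↦ binom(z,i)) for i ∈ ℕ. Then for every j ∈ ℕ: the function z ↦ binom(z,j)·ζ^z on ℤ_p is of class C^r, the series Σ_{i=j}^∞ a_i · binom(i,j) · (ζ−1)^{i−j} converges in L', and Σ_{i=j}^∞ a_i · binom(i,j) · (ζ−1)^{i−j} = ζ^{−j} · μ(z ↦ binom(z,j)·ζ^z). -/

import Mathlib

open Filter Topology Classical

noncomputable section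

namespace Paper

variable (p : ℕ) [Fact p.Prime]
variable (L : Type) [NontriviallyNormedField L] [NormedAlgebra ℚ_[p] L]

/-- The canonical embedding `ℚ_p → L`. -/
noncomputable def iotaL : ℚ_[p] → L := algebraMap ℚ_[p] L

/-- The binomial coefficient `binom(z, n) = z(z-1)⋯(z-n+1)/n!` of a `p`-adic
integer, computed in `ℚ_p`. -/
noncomputable def binomQ (z : ℤ_[p]) (n : ℕ) : ℚ_[p] :=
  (∏ i ∈ Finset.range n, ((z : ℚ_[p]) - (i : ℚ_[p]))) / (n.factorial : ℚ_[p])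

/-- The Mahler coefficients `a_n(f) = ∑_{i=0}^n (-1)^i binom(n,i) f(n-i)`. -/
noncomputable def mahlerCoeff (f : ℤ_[p] → L) (n : ℕ) : L :=
  ∑ i ∈ Finset.range (n + 1), (-1 : L) ^ i * (n.choose i : L) * f (((n - i : ℕ) : ℤ_[p]))

/-- `f : ℤ_p → L` is of class `C^r` : the scaled Mahler coefficients
`n^r a_n(f)` tend to `0`, and `f` is the sum of its Mahler expansion. -/
def IsCr (r : ℝ) (f : ℤ_[p] → L) : Prop :=
  Tendsto (fun n : ℕ => (n : ℝ) ^ r * ‖mahlerCoeff p L f n‖) atTop (nhds 0) ∧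
  ∀ z : ℤ_[p], HasSum (fun n : ℕ => mahlerCoeff p L f n * iotaL p L (binomQ p z n)) (f z)

/-- The norm `‖f‖_r = sup_n (n+1)^r ‖a_n(f)‖` on `C^r(ℤ_p, L)`. -/
noncomputable def crNorm (r : ℝ) (f : ℤ_[p] → L) : ℝ :=
  ⨆ n : ℕ, ((n : ℝ) + 1) ^ r * ‖mahlerCoeff p L f n‖

/-- A continuous (= bounded) linear functional on `C^r(ℤ_p, L)`, i.e. a tempered
distribution of order `r`. -/
structure CrDual (r : ℝ) where
  toFun : (ℤ_[p] → L) → L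
  map_add' : ∀ f g : ℤ_[p] → L, IsCr p L r f → IsCr p L r g →
    toFun (f + g) = toFun f + toFun g
  map_smul' : ∀ (c : L) (f : ℤ_[p] → L), IsCr p L r f → toFun (c • f) = c * toFun f
  bound' : ∃ C : ℝ, ∀ f : ℤ_[p] → L, IsCr p L r f → ‖toFun f‖ ≤ C * crNorm p L r f

/-- The function `z ↦ 1_{a + pⁿℤ_p}(z) (z - a)^j`. -/
noncomputable def indPoly (a : ℤ_[p]) (n : ℕ) (j : ℕ) : ℤ_[p] → L := fun z =>
  if ‖z - a‖ ≤ (p : ℝ) ^ (-(n : ℤ)) then (iotaL p L ((z : ℚ_[p]) - (a : ℚ_[p]))) ^ j else 0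

/-- The norm `‖μ‖_{r,d} = sup_{a, 0 ≤ j ≤ d, n} p^{n(j-r)} ‖∫_{a+pⁿℤ_p} (z-a)^j dμ‖`. -/
noncomputable def dualNormRD (r : ℝ) (d : ℕ) (μ : CrDual p L r) : ℝ :=
  ⨆ (a : ℤ_[p]) (j : Fin (d + 1)) (n : ℕ),
    (p : ℝ) ^ ((n : ℝ) * (((j : ℕ) : ℝ) - r)) * ‖μ.toFun (indPoly p L a n j)‖

/-- `f : ℤ_p → L` is locally polynomial of local degree at most `d`. -/
def IsLocPoly (d : ℕ) (f : ℤ_[p] → L) : Prop :=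
  ∃ n : ℕ, ∀ a : ℤ_[p], ∃ P : Polynomial L, P.natDegree ≤ d ∧
    ∀ z : ℤ_[p], ‖z - a‖ ≤ (p : ℝ) ^ (-(n : ℤ)) → f z = Polynomial.eval (iotaL p L (z : ℚ_[p])) P

/-- A linear functional on `Pol^d(ℤ_p, L)`. -/
structure PolDual (d : ℕ) where
  toFun : (ℤ_[p] → L) → L
  map_add' : ∀ f g : ℤ_[p] → L, IsLocPoly p L d f → IsLocPoly p L d g →
    toFun (f + g) = toFun f + toFun g
  map_smul' : ∀ (c : L) (f : ℤ_[p] → L), IsLocPoly p L d f → toFun (c • f) = c * toFun f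

/-- `ζ^z = ∑_{i≥0} binom(z,i) (ζ-1)^i` for `z ∈ ℤ_p` and `‖ζ - 1‖ < 1`. -/
noncomputable def zetaPow (ζ : L) (z : ℤ_[p]) : L :=
  ∑' i : ℕ, iotaL p L (binomQ p z i) * (ζ - 1) ^ i

section Binomial

theorem binomQ_eq_coe_choose {p : ℕ} [Fact p.Prime] (z : ℤ_[p]) (n : ℕ) :
    binomQ p z n = ((Ring.choose z n : ℤ_[p]) : ℚ_[p]) := by
  have h := Ring.descPochhammer_eq_factorial_smul_choose z n
  rw [← Polynomial.aeval_eq_smeval, Polynomial.aeval_def, Polynomial.eval₂_eq_eval_map,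
    descPochhammer_map, descPochhammer_eval_eq_prod_range, nsmul_eq_mul] at h
  have h' := congrArg (PadicInt.Coe.ringHom (p := p)) h
  rw [map_prod, map_mul] at h'
  simp only [map_sub, map_natCast] at h'
  rw [binomQ, div_eq_iff (Nat.cast_ne_zero.2 n.factorial_ne_zero), mul_comm]
  exact h'

variable {p : ℕ} [Fact p.Prime]
variable (L : Type) [NontriviallyNormedField L] [NormedAlgebra ℚ_[p] L]

theorem norm_iotaL_binomQ_le_one (z : ℤ_[p]) (n : ℕ) : ‖iotaL p L (binomQ p z n)‖ ≤ 1 := by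
  rw [iotaL, norm_algebraMap', binomQ_eq_coe_choose]
  exact PadicInt.norm_le_one _

theorem iotaL_binomQ_natCast (k n : ℕ) :
    iotaL p L (binomQ p (k : ℤ_[p]) n) = (k.choose n : L) := by
  rw [binomQ_eq_coe_choose, Ring.choose_natCast, iotaL]
  simp

theorem iotaL_binomQ_zero (z : ℤ_[p]) : iotaL p L (binomQ p z 0) = 1 := by
  simp [binomQ, iotaL]

theorem iotaL_binomQ_succ_succ (z : ℤ_[p]) (n : ℕ) :
    iotaL p L (binomQ p (z + 1) (n + 1)) =
      iotaL p L (binomQ p z n) + iotaL p L (binomQ p z (n + 1)) := by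
  simp [binomQ_eq_coe_choose, Ring.choose_succ_succ, iotaL]

theorem choose_mul_iotaL_binomQ (z : ℤ_[p]) (j t : ℕ) :
    ((j + t).choose j : L) * iotaL p L (binomQ p z (j + t)) =
      iotaL p L (binomQ p z j) * iotaL p L (binomQ p (z - j) t) := by
  have h := Ring.choose_smul_choose z (Nat.le_add_right j t)
  rw [Nat.add_sub_cancel_left, nsmul_eq_mul] at h
  have h' := congrArg (fun x : ℤ_[p] => algebraMap ℚ_[p] L (x : ℚ_[p])) h
  simpa [binomQ_eq_coe_choose, iotaL] using h'

end Binomial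

section MahlerCoeff

variable {p : ℕ} [Fact p.Prime]
variable {L : Type} [NontriviallyNormedField L]

theorem mahlerCoeff_add (f g : ℤ_[p] → L) (n : ℕ) :
    mahlerCoeff p L (f + g) n = mahlerCoeff p L f n + mahlerCoeff p L g n := by
  simp [mahlerCoeff, mul_add, Finset.sum_add_distrib]

theorem mahlerCoeff_smul (c : L) (f : ℤ_[p] → L) (n : ℕ) :
    mahlerCoeff p L (c • f) n = c * mahlerCoeff p L f n := by
  simp only [mahlerCoeff, Finset.mul_sum, Pi.smul_apply, smul_eq_mul]
  exact Finset.sum_congr rfl fun _ _ => by ring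

theorem mahlerCoeff_eq_fwdDiff (f : ℤ_[p] → L) (n : ℕ) :
    mahlerCoeff p L f n = (fwdDiff 1)^[n] (fun k : ℕ => f (k : ℤ_[p])) 0 := by
  rw [fwdDiff_iter_eq_sum_shift, mahlerCoeff, ← Finset.sum_range_reflect]
  refine Finset.sum_congr rfl fun k hk => ?_
  have hk : k ≤ n := Nat.lt_succ_iff.mp (Finset.mem_range.mp hk)
  have h1 : n + 1 - 1 - k = n - k := by omega
  have h2 : n - (n - k) = k := by omega
  rw [h1, h2, Nat.choose_symm hk]
  simp [zsmul_eq_mul]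

variable [NormedAlgebra ℚ_[p] L]

/-- The coefficients of a pointwise convergent Mahler expansion are the Mahler coefficients. -/
theorem mahlerCoeff_eq_of_hasSum {f : ℤ_[p] → L} {c : ℕ → L}
    (h : ∀ z : ℤ_[p], HasSum (fun n : ℕ => c n * iotaL p L (binomQ p z n)) (f z)) (n : ℕ) :
    mahlerCoeff p L f n = c n := by
  have hval : ∀ k ≤ n, f (k : ℤ_[p]) = ∑ j ∈ Finset.range (n + 1), (k.choose j : ℤ) • c j := by
    intro k hk
    have hfin : ∀ j ∉ Finset.range (n + 1), c j * iotaL p L (binomQ p (k : ℤ_[p]) j) = 0 := by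
      intro j hj
      rw [iotaL_binomQ_natCast, Nat.choose_eq_zero_of_lt (by simp at hj; omega)]
      simp
    rw [(h k).unique (hasSum_sum_of_ne_finset_zero hfin)]
    exact Finset.sum_congr rfl fun j _ => by
      rw [iotaL_binomQ_natCast, zsmul_eq_mul, Int.cast_natCast, mul_comm]
  calc mahlerCoeff p L f n
      = (fwdDiff 1)^[n] (fun k : ℕ => ∑ j ∈ Finset.range (n + 1), (k.choose j : ℤ) • c j) 0 := by
        rw [mahlerCoeff_eq_fwdDiff]
        simp only [fwdDiff_iter_eq_sum_shift, zero_add]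
        refine Finset.sum_congr rfl fun j hj => ?_
        rw [hval _ (by simpa [Nat.lt_succ_iff] using hj)]
    _ = ∑ j ∈ Finset.range (n + 1), ((fwdDiff 1)^[n] (fun k ↦ k.choose j : ℕ → ℤ) 0) • c j := by
        simp only [fwdDiff_iter_eq_sum_shift, Finset.smul_sum, zero_add, Finset.sum_smul,
          smul_assoc]
        rw [Finset.sum_comm]
    _ = c n := by
        simp [fwdDiff_iter_choose_zero]

theorem isCr_of_hasSum {r : ℝ} {f : ℤ_[p] → L} {c : ℕ → L}
    (hc : Tendsto (fun n : ℕ => (n : ℝ) ^ r * ‖c n‖) atTop (𝓝 0))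
    (h : ∀ z : ℤ_[p], HasSum (fun n : ℕ => c n * iotaL p L (binomQ p z n)) (f z)) :
    IsCr p L r f := by
  have hf : mahlerCoeff p L f = c := funext (mahlerCoeff_eq_of_hasSum h)
  rw [IsCr, hf]
  exact ⟨hc, h⟩

theorem hasSum_single_mul_binomQ (k : ℕ) (z : ℤ_[p]) :
    HasSum (fun n : ℕ => (Pi.single k 1 : ℕ → L) n * iotaL p L (binomQ p z n))
      (iotaL p L (binomQ p z k)) := by
  have h : ∀ n, n ≠ k → (Pi.single k 1 : ℕ → L) n * iotaL p L (binomQ p z n) = 0 :=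
    fun n hn => by simp [hn]
  simpa using hasSum_single k h

theorem mahlerCoeff_binomQ (k n : ℕ) :
    mahlerCoeff p L (fun z => iotaL p L (binomQ p z k)) n = (Pi.single k 1 : ℕ → L) n :=
  mahlerCoeff_eq_of_hasSum (hasSum_single_mul_binomQ k) n

theorem isCr_binomQ (r : ℝ) (k : ℕ) : IsCr p L r (fun z => iotaL p L (binomQ p z k)) := by
  refine isCr_of_hasSum (c := Pi.single k 1) ?_ (hasSum_single_mul_binomQ k)
  refine tendsto_const_nhds.congr' ?_
  filter_upwards [eventually_gt_atTop k] with n hn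
  simp [hn.ne']

theorem IsCr.smul {r : ℝ} {f : ℤ_[p] → L} (hf : IsCr p L r f) (c : L) : IsCr p L r (c • f) := by
  refine isCr_of_hasSum (c := fun n => c * mahlerCoeff p L f n) ?_ fun z => ?_
  · simpa [mul_left_comm] using hf.1.const_mul ‖c‖
  · simpa [mul_assoc] using (hf.2 z).mul_left c

theorem IsCr.add {r : ℝ} {f g : ℤ_[p] → L} (hf : IsCr p L r f) (hg : IsCr p L r g) :
    IsCr p L r (f + g) := by
  refine isCr_of_hasSum (c := fun n => mahlerCoeff p L f n + mahlerCoeff p L g n) ?_ fun z => ?_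
  · refine squeeze_zero (fun n => by positivity) (fun n => ?_) (by simpa using hf.1.add hg.1)
    rw [← mul_add]
    gcongr
    exact norm_add_le _ _
  · simpa [add_mul] using (hf.2 z).add (hg.2 z)

theorem isCr_sum_binomQ (r : ℝ) (c : ℕ → L) (s : Finset ℕ) :
    IsCr p L r (∑ n ∈ s, c n • fun z => iotaL p L (binomQ p z n)) := by
  induction s using Finset.induction_on with
  | empty => simpa using (isCr_binomQ (p := p) r 0).smul (0 : L)
  | insert a s ha ih =>
    rw [Finset.sum_insert ha]
    exact ((isCr_binomQ r a).smul _).add ih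

theorem mahlerCoeff_sum_binomQ (c : ℕ → L) (s : Finset ℕ) (k : ℕ) :
    mahlerCoeff p L (∑ n ∈ s, c n • fun z => iotaL p L (binomQ p z n)) k =
      if k ∈ s then c k else 0 := by
  induction s using Finset.induction_on with
  | empty => simp [mahlerCoeff]
  | insert a s ha ih =>
    rw [Finset.sum_insert ha, mahlerCoeff_add, mahlerCoeff_smul, mahlerCoeff_binomQ, ih]
    by_cases hk : k = a
    · subst hk
      simp [ha]
    · simp [hk]

theorem CrDual.map_sum_binomQ {r : ℝ} (μ : CrDual p L r) (c : ℕ → L) (s : Finset ℕ) :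
    μ.toFun (∑ n ∈ s, c n • fun z => iotaL p L (binomQ p z n)) =
      ∑ n ∈ s, c n * μ.toFun (fun z => iotaL p L (binomQ p z n)) := by
  induction s using Finset.induction_on with
  | empty => simpa using μ.map_smul' 0 _ (isCr_binomQ r 0)
  | insert a s ha ih =>
    rw [Finset.sum_insert ha, Finset.sum_insert ha,
      μ.map_add' _ _ ((isCr_binomQ r a).smul _) (isCr_sum_binomQ r c s),
      μ.map_smul' _ _ (isCr_binomQ r a), ih]

/-- The bound `n ^ r * ‖a_n‖ → 0` may be shifted to `(n + 1) ^ r * ‖a_n‖ → 0`. -/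
theorem IsCr.tendsto_add_one {r : ℝ} (hr : 0 ≤ r) {f : ℤ_[p] → L} (hf : IsCr p L r f) :
    Tendsto (fun n : ℕ => ((n : ℝ) + 1) ^ r * ‖mahlerCoeff p L f n‖) atTop (𝓝 0) := by
  refine squeeze_zero' (Eventually.of_forall fun n => by positivity) ?_
    (by simpa using hf.1.const_mul ((2 : ℝ) ^ r))
  filter_upwards [eventually_ge_atTop 1] with n hn
  have hn' : (1 : ℝ) ≤ n := by exact_mod_cast hn
  rw [← mul_assoc, ← Real.mul_rpow (by norm_num) (by positivity)]
  gcongr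
  linarith

/-- A continuous functional on `C^r` may be evaluated termwise on Mahler expansions. -/
theorem CrDual.hasSum_mahler {r : ℝ} (hr : 0 ≤ r) (μ : CrDual p L r) {f : ℤ_[p] → L}
    (hf : IsCr p L r f) :
    HasSum (fun n => mahlerCoeff p L f n * μ.toFun (fun z => iotaL p L (binomQ p z n)))
      (μ.toFun f) := by
  obtain ⟨C, hC⟩ := μ.bound'
  rw [HasSum, SummationFilter.unconditional_filter, Metric.tendsto_atTop]
  intro ε hε
  set δ := ε / (2 * (|C| + 1)) with hδ
  have hδ0 : 0 < δ := by positivity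
  obtain ⟨N, hN⟩ := eventually_atTop.1 ((hf.tendsto_add_one hr).eventually_le_const hδ0)
  refine ⟨Finset.range N, fun s hs => ?_⟩
  set h : ℤ_[p] → L := ∑ n ∈ s, mahlerCoeff p L f n • fun z => iotaL p L (binomQ p z n) with hh
  have hCr : IsCr p L r h := isCr_sum_binomQ r _ s
  have htail : IsCr p L r (f + (-1 : L) • h) := hf.add (hCr.smul _)
  have hμ : μ.toFun (f + (-1 : L) • h) = μ.toFun f -
      ∑ n ∈ s, mahlerCoeff p L f n * μ.toFun (fun z => iotaL p L (binomQ p z n)) := by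
    rw [μ.map_add' _ _ hf (hCr.smul _), μ.map_smul' _ _ hCr, hh, μ.map_sum_binomQ]
    ring
  have hnorm0 : 0 ≤ crNorm p L r (f + (-1 : L) • h) := Real.iSup_nonneg fun n => by positivity
  have hnorm : crNorm p L r (f + (-1 : L) • h) ≤ δ := by
    refine ciSup_le fun n => ?_
    rw [mahlerCoeff_add, mahlerCoeff_smul, hh, mahlerCoeff_sum_binomQ]
    split_ifs with hn
    · simpa using hδ0.le
    · have : N ≤ n := by
        by_contra hlt
        exact hn (hs (Finset.mem_range.2 (not_le.1 hlt)))
      simpa using hN n this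
  rw [dist_comm, dist_eq_norm, ← hμ]
  calc ‖μ.toFun (f + (-1 : L) • h)‖ ≤ C * crNorm p L r (f + (-1 : L) • h) := hC _ htail
    _ ≤ (|C| + 1) * δ := by
        gcongr
        linarith [le_abs_self C]
    _ = ε / 2 := by
        rw [hδ]
        field_simp
    _ < ε := half_lt_self hε

end MahlerCoeff

section RootOfUnity

theorem tendsto_rpow_mul_norm_choose_mul_pow {L : Type} [NontriviallyNormedField L]
    [IsUltrametricDist L] {x : L} (hx : ‖x‖ < 1)
    (c : L) (r : ℝ) (j : ℕ) :
    Tendsto (fun n : ℕ => (n : ℝ) ^ r * ‖c * (n.choose j : L) * x ^ (n - j)‖) atTop (𝓝 0) := by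
  obtain ⟨q, hxq, hq1⟩ := exists_between hx
  have hq0 : 0 < q := (norm_nonneg x).trans_lt hxq
  have hlim : Tendsto (fun n : ℕ => ‖c‖ * (q ^ j)⁻¹ * ((n : ℝ) ^ ⌈r⌉₊ * q ^ n)) atTop (𝓝 0) := by
    simpa using (tendsto_pow_const_mul_const_pow_of_lt_one ⌈r⌉₊ hq0.le hq1).const_mul
      (‖c‖ * (q ^ j)⁻¹)
  refine squeeze_zero' (Eventually.of_forall fun n => by positivity) ?_ hlim
  filter_upwards [eventually_ge_atTop (max 1 j)] with n hn
  have hn1 : (1 : ℝ) ≤ n := by exact_mod_cast (le_max_left 1 j).trans hn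
  have hnj : j ≤ n := (le_max_right 1 j).trans hn
  have h1 : (n : ℝ) ^ r ≤ (n : ℝ) ^ ⌈r⌉₊ := by
    rw [← Real.rpow_natCast]
    exact Real.rpow_le_rpow_of_exponent_le hn1 (Nat.le_ceil r)
  have h2 : ‖c * (n.choose j : L) * x ^ (n - j)‖ ≤ ‖c‖ * 1 * q ^ (n - j) := by
    rw [norm_mul, norm_mul, norm_pow]
    gcongr
    exact IsUltrametricDist.norm_natCast_le_one L _
  calc (n : ℝ) ^ r * ‖c * (n.choose j : L) * x ^ (n - j)‖
      ≤ (n : ℝ) ^ ⌈r⌉₊ * (‖c‖ * 1 * q ^ (n - j)) := by gcongr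
    _ = ‖c‖ * (q ^ j)⁻¹ * ((n : ℝ) ^ ⌈r⌉₊ * q ^ n) := by
        rw [pow_sub₀ q hq0.ne' hnj]
        ring

variable {p : ℕ} [Fact p.Prime]
variable {L : Type} [NontriviallyNormedField L] [NormedAlgebra ℚ_[p] L]

theorem norm_sub_one_lt_one_of_pow_prime_pow_eq_one [IsUltrametricDist L] {m : ℕ} {ζ : L}
    (hζ : ζ ^ p ^ m = 1) : ‖ζ - 1‖ < 1 := by
  have hp : p.Prime := Fact.out
  have hpm : p ^ m ≠ 0 := (pow_pos hp.pos m).ne'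
  have hnζ : ‖ζ‖ = 1 := by
    have := congrArg norm hζ
    rw [norm_pow, norm_one] at this
    exact (pow_eq_one_iff_of_nonneg (norm_nonneg _) hpm).1 this
  have hx : ‖ζ - 1‖ ≤ 1 := by
    simpa [hnζ, sub_eq_add_neg] using IsUltrametricDist.norm_add_le_max ζ (-1)
  let x : (NormedField.valuation (K := L)).integer := ⟨ζ - 1, hx⟩
  obtain ⟨s, hs⟩ := exists_add_pow_prime_pow_eq hp x 1 m
  have hs' := congrArg (Subtype.val) hs
  have hsn : ‖(s : L)‖ ≤ 1 := s.2
  have key : (ζ - 1) ^ p ^ m = -((p : L) * (ζ - 1) * s) := by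
    have h1 : (ζ - 1 + 1) ^ p ^ m = (ζ - 1) ^ p ^ m + 1 + (p : L) * (ζ - 1) * s := by
      simpa [x] using hs'
    rw [sub_add_cancel, hζ] at h1
    linear_combination -h1
  have hpn : ‖(p : L)‖ < 1 := by
    have := norm_algebraMap' L (p : ℚ_[p])
    rw [map_natCast] at this
    rw [this]
    exact Padic.norm_p_lt_one
  by_contra hge
  have h1 : ‖ζ - 1‖ = 1 := le_antisymm hx (not_lt.1 hge)
  have h2 := congrArg norm key
  rw [norm_pow, norm_neg, norm_mul, norm_mul, h1, one_pow, mul_one] at h2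
  nlinarith [norm_nonneg (p : L), norm_nonneg (s : L)]

variable [CompleteSpace L]

theorem summable_zetaPow {ζ : L} (hζ : ‖ζ - 1‖ < 1) (z : ℤ_[p]) :
    Summable (fun i : ℕ => iotaL p L (binomQ p z i) * (ζ - 1) ^ i) := by
  refine Summable.of_norm_bounded (summable_geometric_of_lt_one (norm_nonneg _) hζ) fun i => ?_
  rw [norm_mul, norm_pow]
  exact mul_le_of_le_one_left (by positivity) (norm_iotaL_binomQ_le_one L z i)

theorem zetaPow_add_one {ζ : L} (hζ : ‖ζ - 1‖ < 1) (z : ℤ_[p]) :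
    zetaPow p L ζ (z + 1) = ζ * zetaPow p L ζ z := by
  have hs := summable_zetaPow hζ z
  have hs' := (summable_nat_add_iff 1).2 hs
  have h1 := (summable_zetaPow hζ (z + 1)).tsum_eq_zero_add
  have h0 := hs.tsum_eq_zero_add
  have h2 : ∑' i : ℕ, iotaL p L (binomQ p (z + 1) (i + 1)) * (ζ - 1) ^ (i + 1) =
      (ζ - 1) * zetaPow p L ζ z +
        ∑' i : ℕ, iotaL p L (binomQ p z (i + 1)) * (ζ - 1) ^ (i + 1) := by
    rw [zetaPow, ← tsum_mul_left, ← (hs.mul_left (ζ - 1)).tsum_add hs']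
    refine tsum_congr fun i => ?_
    rw [iotaL_binomQ_succ_succ]
    ring
  rw [iotaL_binomQ_zero, h2] at h1
  rw [iotaL_binomQ_zero] at h0
  change zetaPow p L ζ (z + 1) = _ at h1
  change zetaPow p L ζ z = _ at h0
  linear_combination h1 - h0

theorem zetaPow_add_natCast {ζ : L} (hζ : ‖ζ - 1‖ < 1) (z : ℤ_[p]) (j : ℕ) :
    zetaPow p L ζ (z + j) = ζ ^ j * zetaPow p L ζ z := by
  induction j with
  | zero => simp
  | succ j ih =>
    rw [Nat.cast_succ, ← add_assoc, zetaPow_add_one hζ, ih]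
    ring

/-- The Mahler expansion of `z ↦ binom(z,j) ζ^z`. -/
theorem hasSum_binomQ_mul_zetaPow {ζ : L} (hζ : ‖ζ - 1‖ < 1) (j : ℕ) (z : ℤ_[p]) :
    HasSum (fun n : ℕ => ζ ^ j * (n.choose j : L) * (ζ - 1) ^ (n - j) *
      iotaL p L (binomQ p z n)) (iotaL p L (binomQ p z j) * zetaPow p L ζ z) := by
  have hz : zetaPow p L ζ z = ζ ^ j * zetaPow p L ζ (z - j) := by
    rw [← zetaPow_add_natCast hζ, sub_add_cancel]
  rw [← (add_right_injective j).hasSum_iff]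
  · have h := (summable_zetaPow hζ (z - (j : ℤ_[p]))).hasSum.mul_left
      (iotaL p L (binomQ p z j) * ζ ^ j)
    rw [hz, zetaPow, ← mul_assoc]
    refine h.congr_fun fun t => ?_
    simp only [Function.comp_apply, Nat.add_sub_cancel_left]
    linear_combination ζ ^ j * (ζ - 1) ^ t * choose_mul_iotaL_binomQ L z j t
  · intro n hn
    have : n < j := by
      by_contra hle
      exact hn ⟨n - j, by simp; omega⟩
    simp [Nat.choose_eq_zero_of_lt this]

end RootOfUnity

/-- Let `ζ` be a primitive `p^m`-th root of unity (`m ≥ 1`), `r ∈ ℝ≥0`, `μ` a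
continuous linear functional on `C^r(ℤ_p, L')`, and `a_i = μ(binom(·,i))`.
Then for every `j` : `z ↦ binom(z,j) ζ^z` is of class `C^r`, the series
`∑_{i≥j} a_i binom(i,j) (ζ-1)^{i-j}` converges, and its sum equals
`ζ^{-j} μ(z ↦ binom(z,j) ζ^z)`. -/
theorem statement19 (p : ℕ) [Fact p.Prime] (L : Type) [NontriviallyNormedField L]
    [NormedAlgebra ℚ_[p] L] [CompleteSpace L] [IsUltrametricDist L]
    (m : ℕ) (hm : 1 ≤ m) (ζ : L) (hζ : ζ ^ p ^ m = 1) (hζ' : ζ ^ p ^ (m - 1) ≠ 1)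
    (r : ℝ) (hr : 0 ≤ r) (μ : CrDual p L r) :
    ∀ j : ℕ,
      IsCr p L r (fun z : ℤ_[p] => iotaL p L (binomQ p z j) * zetaPow p L ζ z) ∧
      Summable (fun t : ℕ =>
        μ.toFun (fun z : ℤ_[p] => iotaL p L (binomQ p z (j + t))) *
          ((j + t).choose j : L) * (ζ - 1) ^ t) ∧
      (∑' t : ℕ,
          μ.toFun (fun z : ℤ_[p] => iotaL p L (binomQ p z (j + t))) *
            ((j + t).choose j : L) * (ζ - 1) ^ t)
        = ζ ^ (-(j : ℤ)) *
            μ.toFun (fun z : ℤ_[p] => iotaL p L (binomQ p z j) * zetaPow p L ζ z) := by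
  intro j
  have hlt : ‖ζ - 1‖ < 1 := norm_sub_one_lt_one_of_pow_prime_pow_eq_one (p := p) hζ
  have hζ0 : ζ ≠ 0 := by
    rintro rfl
    simp at hlt
  have hsum := hasSum_binomQ_mul_zetaPow (p := p) hlt j
  have hCr : IsCr p L r (fun z : ℤ_[p] => iotaL p L (binomQ p z j) * zetaPow p L ζ z) :=
    isCr_of_hasSum (tendsto_rpow_mul_norm_choose_mul_pow hlt (ζ ^ j) r j) hsum
  have hμ := μ.hasSum_mahler hr hCr
  simp only [mahlerCoeff_eq_of_hasSum hsum] at hμ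
  rw [← (add_right_injective j).hasSum_iff] at hμ
  · have hmain : HasSum (fun t : ℕ =>
        μ.toFun (fun z : ℤ_[p] => iotaL p L (binomQ p z (j + t))) *
          ((j + t).choose j : L) * (ζ - 1) ^ t)
        (ζ ^ (-(j : ℤ)) *
          μ.toFun (fun z : ℤ_[p] => iotaL p L (binomQ p z j) * zetaPow p L ζ z)) := by
      refine (hμ.mul_left (ζ ^ (-(j : ℤ)))).congr_fun fun t => ?_
      simp only [Function.comp_apply, Nat.add_sub_cancel_left, zpow_neg, zpow_natCast]
      field_simp
    exact ⟨hCr, hmain.summable, hmain.tsum_eq⟩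
  · intro n hn
    have : n < j := by
      by_contra hle
      exact hn ⟨n - j, by simp; omega⟩
    simp [Nat.choose_eq_zero_of_lt this]

end Paper

end
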